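/- Let Ω ⊆ ℝ³ be a bounded open set, ξ ∈ Ω, H a regular part of the Green's function of Ω at ξ with H(ξ) > 0, G_ξ = Γ_ξ − H, and r_Ω(ξ) = 1/√(8π H(ξ)). For τ > 0 let Ω(τ) = {ξ} ∪ {η ∈ Ω ∖ {ξ} : G_ξ(η) > τ} and r_{Ω(τ)}(ξ) = r_Ω(ξ)/√(8π τ r_Ω(ξ)² + 1). Then |B(0, r_{Ω(τ)}(ξ))| ≤ α_Ω(ξ)⁴ · |Ω(τ)|, where α_Ω(ξ) = (sup_{η∈∂Ω} d(ξ,η))/(inf_{η∈∂Ω} d(ξ,η)). -/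

import Mathlib

open MeasureTheory Real Set

noncomputable section

/-- The underlying space of the Heisenberg group ℍ¹: ℝ³ with coordinates (x, y, t). -/
abbrev H1 : Type := ℝ × ℝ × ℝ

/-- The Koranyi norm ρ(x,y,t) = ((x²+y²)² + t²)^{1/4}. -/
def ρH (η : H1) : ℝ := ((η.1 ^ 2 + η.2.1 ^ 2) ^ 2 + η.2.2 ^ 2) ^ ((1 : ℝ) / 4)

/-- The Heisenberg group law: η∘ξ = (x+x₀, y+y₀, t+t₀+2(x₀y − x y₀)). -/
def hmul (η ξ : H1) : H1 :=
  (η.1 + ξ.1, η.2.1 + ξ.2.1, η.2.2 + ξ.2.2 + 2 * (ξ.1 * η.2.1 - η.1 * ξ.2.1))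

/-- The Heisenberg group inverse: ξ⁻¹ = (−x₀,−y₀,−t₀). -/
def hinv (ξ : H1) : H1 := (-ξ.1, -ξ.2.1, -ξ.2.2)

/-- The Koranyi distance d(ξ,η) = ρ(ξ⁻¹∘η). -/
def kd (ξ η : H1) : ℝ := ρH (hmul (hinv ξ) η)

/-- The Koranyi ball B(ξ,r) = {η : d(ξ,η) < r}. -/
def kball (ξ : H1) (r : ℝ) : Set H1 := {η | kd ξ η < r}

/-- Horizontal derivative Xu = ∂u/∂x + 2y·∂u/∂t, as the derivative along (1,0,2y). -/
def Xd (u : H1 → ℝ) (η : H1) : ℝ := fderiv ℝ u η (1, 0, 2 * η.2.1)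

/-- Horizontal derivative Yu = ∂u/∂y − 2x·∂u/∂t, as the derivative along (0,1,−2x). -/
def Yd (u : H1 → ℝ) (η : H1) : ℝ := fderiv ℝ u η (0, 1, -2 * η.1)

/-- The Kohn-Laplacian Δ_ℍ u = X(Xu) + Y(Yu). -/
def kohn (u : H1 → ℝ) (η : H1) : ℝ := Xd (Xd u) η + Yd (Yd u) η

/-- The fundamental solution with pole ξ: Γ_ξ(η) = 1/(8π d(ξ,η)²). -/
def Γξ (ξ η : H1) : ℝ := 1 / (8 * π * kd ξ η ^ 2)

/-- A set A satisfies the uniform exterior ball property if there exists r₀ > 0 such that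
for every ζ ∈ ∂A and every r ∈ (0,r₀] there exists η with B(η,r) ∩ A = ∅ and ζ ∈ ∂B(η,r). -/
def uebp (A : Set H1) : Prop :=
  ∃ r₀ > (0 : ℝ), ∀ ζ ∈ frontier A, ∀ r : ℝ, 0 < r → r ≤ r₀ →
    ∃ η : H1, kball η r ∩ A = ∅ ∧ ζ ∈ frontier (kball η r)

/-- Ω has C¹ boundary: it is the sublevel set of a C¹ defining function with
nonvanishing gradient on the boundary. -/
def c1Bdry (Ω : Set H1) : Prop :=
  ∃ f : H1 → ℝ, ContDiff ℝ 1 f ∧ Ω = {x | f x < 0} ∧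
    frontier Ω = {x | f x = 0} ∧ ∀ x ∈ frontier Ω, fderiv ℝ f x ≠ 0

/-- Ω has smooth boundary: it is the sublevel set of a smooth defining function with
nonvanishing gradient on the boundary. -/
def smoothBdry (Ω : Set H1) : Prop :=
  ∃ f : H1 → ℝ, ContDiff ℝ (⊤ : ℕ∞) f ∧ Ω = {x | f x < 0} ∧
    frontier Ω = {x | f x = 0} ∧ ∀ x ∈ frontier Ω, fderiv ℝ f x ≠ 0

/-- The horizontal perimeter of Ω:
P_ℍ(Ω) = sup { ∫_Ω (Xa + Yb) : a,b of class C¹ with a²+b² ≤ 1 }. -/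
def horizPerim (Ω : Set H1) : ℝ :=
  sSup { p : ℝ | ∃ a b : H1 → ℝ, ContDiff ℝ 1 a ∧ ContDiff ℝ 1 b ∧
    (∀ η, a η ^ 2 + b η ^ 2 ≤ 1) ∧ p = ∫ η in Ω, (Xd a η + Yd b η) }

/-- The first Dirichlet eigenvalue of the Kohn-Laplacian on Ω, via the Rayleigh quotient. -/
def lam1 (Ω : Set H1) : ℝ :=
  sInf { q : ℝ | ∃ v : H1 → ℝ, ContDiff ℝ (⊤ : ℕ∞) v ∧ HasCompactSupport v ∧ tsupport v ⊆ Ω ∧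
    v ≠ 0 ∧ q = (∫ η in Ω, ((Xd v η) ^ 2 + (Yd v η) ^ 2)) / (∫ η in Ω, (v η) ^ 2) }

/-- The Bessel function of the first kind of order 1,
J₁(l) = (l/2)·Σ_{k=0}^∞ ((−1)^k/(k!·(k+1)!))·(l/2)^{2k}. -/
def J1 (l : ℝ) : ℝ :=
  (l / 2) * ∑' k : ℕ,
    ((-1 : ℝ) ^ k / ((Nat.factorial k : ℝ) * (Nat.factorial (k + 1) : ℝ))) * (l / 2) ^ (2 * k)

section

open Topology Filter

lemma ρH_nonneg (η : H1) : 0 ≤ ρH η := by unfold ρH; positivity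

lemma ρH_pow_four (η : H1) : ρH η ^ 4 = (η.1 ^ 2 + η.2.1 ^ 2) ^ 2 + η.2.2 ^ 2 := by
  unfold ρH
  rw [← Real.rpow_natCast, ← Real.rpow_mul (by positivity)]
  norm_num

lemma continuous_ρH : Continuous ρH := by
  unfold ρH
  exact Continuous.rpow_const (by fun_prop) fun _ => Or.inr (by norm_num)

lemma continuous_kd (ξ : H1) : Continuous (kd ξ) :=
  continuous_ρH.comp (by unfold hmul hinv; fun_prop)

lemma kd_nonneg (ξ η : H1) : 0 ≤ kd ξ η := ρH_nonneg _

lemma kd_pos {ξ η : H1} (h : η ≠ ξ) : 0 < kd ξ η := by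
  refine (kd_nonneg ξ η).lt_of_ne fun h0 => h ?_
  have h4 := ρH_pow_four (hmul (hinv ξ) η)
  obtain ⟨a, b, c⟩ := ξ
  obtain ⟨x, y, t⟩ := η
  change 0 = ρH _ at h0
  rw [← h0] at h4
  simp only [hmul, hinv] at h4
  have hp : (-a + x) ^ 2 + (-b + y) ^ 2 = 0 := by nlinarith [sq_nonneg (-a + x), sq_nonneg (-b + y)]
  have hx : x = a := by nlinarith [sq_nonneg (-a + x), sq_nonneg (-b + y)]
  have hy : y = b := by nlinarith [sq_nonneg (-a + x), sq_nonneg (-b + y)]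
  subst hx hy
  have ht : t = c := by nlinarith
  rw [ht]

lemma kd_zero (η : H1) : kd 0 η = ρH η := by
  simp [kd, hmul, hinv]

/-- The anisotropic dilation (x,y,t) ↦ (cx, cy, c²t). -/
def hdil (c : ℝ) (η : H1) : H1 := (c * η.1, c * η.2.1, c ^ 2 * η.2.2)

lemma ρH_hdil {c : ℝ} (hc : 0 ≤ c) (η : H1) : ρH (hdil c η) = c * ρH η := by
  refine (pow_left_inj₀ (ρH_nonneg _) (mul_nonneg hc (ρH_nonneg _)) (n := 4) (by norm_num)).1 ?_
  rw [mul_pow, ρH_pow_four, ρH_pow_four]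
  simp only [hdil]
  ring

/-- The linear part of the left translation by `ξ⁻¹` followed by the dilation by `c`. -/
def dilTransLinear (c : ℝ) (ξ : H1) : H1 →ₗ[ℝ] H1 where
  toFun η := (c * η.1, c * η.2.1, c ^ 2 * (η.2.2 + 2 * (ξ.1 * η.2.1 - η.1 * ξ.2.1)))
  map_add' η ζ := by ext <;> simp <;> ring
  map_smul' a η := by ext <;> simp <;> ring

/-- The linear identification of ℝ × ℝ × ℝ with `Fin 3 → ℝ`. -/
def tripleEquiv : H1 ≃ₗ[ℝ] (Fin 3 → ℝ) where
  toFun η := ![η.1, η.2.1, η.2.2]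
  invFun v := (v 0, v 1, v 2)
  map_add' η ζ := by ext i; fin_cases i <;> simp
  map_smul' a η := by ext i; fin_cases i <;> simp
  left_inv η := by simp
  right_inv v := by ext i; fin_cases i <;> simp

lemma det_dilTransLinear (c : ℝ) (ξ : H1) : LinearMap.det (dilTransLinear c ξ) = c ^ 4 := by
  have h : dilTransLinear c ξ = (tripleEquiv.symm : (Fin 3 → ℝ) →ₗ[ℝ] H1) ∘ₗ
      (Matrix.toLin' !![c, 0, 0; 0, c, 0; -2 * c ^ 2 * ξ.2.1, 2 * c ^ 2 * ξ.1, c ^ 2]) ∘ₗ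
      (tripleEquiv.symm.symm : H1 →ₗ[ℝ] (Fin 3 → ℝ)) := by
    refine LinearMap.ext fun η => ?_
    ext <;> simp [dilTransLinear, tripleEquiv, Matrix.mulVec, dotProduct, Fin.sum_univ_three]
    ring
  rw [h, LinearMap.det_conj, LinearMap.det_toLin', Matrix.det_fin_three]
  simp
  ring

instance : (volume : Measure H1).IsAddHaarMeasure :=
  haveI : (volume : Measure (ℝ × ℝ)).IsAddHaarMeasure :=
    Measure.prod.instIsAddHaarMeasure volume volume
  Measure.prod.instIsAddHaarMeasure volume volume

lemma volume_kball_zero_le {c s R : ℝ} (hc : 0 < c) (hR : R ≤ c * s) (ξ : H1) :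
    volume (kball 0 R) ≤ ENNReal.ofReal (c ^ 4) * volume (kball ξ s) := by
  have hsub : kball 0 R ⊆
      (fun η => hdil c (hinv ξ) + η) '' (dilTransLinear c ξ '' kball ξ s) := by
    intro ζ hζ
    have hζ' : ρH ζ < R := by rw [← kd_zero]; exact hζ
    refine ⟨_, ⟨hmul ξ (hdil c⁻¹ ζ), ?_, rfl⟩, ?_⟩
    · have h : hmul (hinv ξ) (hmul ξ (hdil c⁻¹ ζ)) = hdil c⁻¹ ζ := by
        ext <;> simp [hmul, hinv, hdil]
        ring
      change ρH _ < s
      rw [h, ρH_hdil (by positivity), inv_mul_lt_iff₀ hc]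
      linarith
    · ext <;> simp [hmul, hinv, hdil, dilTransLinear] <;> field_simp <;> ring
  refine (measure_mono hsub).trans ?_
  rw [Set.image_add_left, measure_preimage_add, Measure.addHaar_image_linearMap,
    det_dilTransLinear, abs_of_pos (by positivity)]

/-- Necessary second-order condition at a local maximum. -/
lemma IsLocalMax.deriv_deriv_nonpos {f : ℝ → ℝ} {x : ℝ} (hf : IsLocalMax f x)
    (hc : ContinuousAt f x) : deriv (deriv f) x ≤ 0 := by
  by_contra! h
  have hmin := isLocalMin_of_deriv_deriv_pos h hf.deriv_eq_zero hc
  have heq : f =ᶠ[𝓝 x] fun _ => f x := by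
    filter_upwards [hf, hmin] with y h1 h2 using le_antisymm h1 h2
  have := heq.deriv.deriv_eq
  simp at this
  linarith

/-- Along a line that is an integral curve of `F`, derivatives along the line are
derivatives along `F`. -/
lemma hasDerivAt_deriv_comp_line {u : H1 → ℝ} {p w : H1} {F : H1 → H1}
    (hu : ContDiffAt ℝ 2 u p) (hF : Differentiable ℝ F) (hw : ∀ s : ℝ, F (p + s • w) = w) :
    (∀ᶠ s in 𝓝 (0 : ℝ), DifferentiableAt ℝ (fun s : ℝ => u (p + s • w)) s) ∧
    HasDerivAt (deriv fun s : ℝ => u (p + s • w))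
      (fderiv ℝ (fun η => fderiv ℝ u η (F η)) p (F p)) 0 := by
  have hline (s : ℝ) : HasDerivAt (fun s : ℝ => p + s • w) w s := by
    simpa using ((hasDerivAt_id s).smul_const w).const_add p
  have htend : Tendsto (fun s : ℝ => p + s • w) (𝓝 0) (𝓝 p) := by
    simpa using (hline 0).continuousAt.tendsto
  have hdiff : ∀ᶠ s in 𝓝 (0 : ℝ), DifferentiableAt ℝ u (p + s • w) :=
    htend.eventually ((hu.eventually (by simp)).mono fun _ h => h.differentiableAt (by norm_num))
  have hd : ∀ᶠ s in 𝓝 (0 : ℝ), HasDerivAt (fun s : ℝ => u (p + s • w))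
      (fderiv ℝ u (p + s • w) (F (p + s • w))) s := by
    filter_upwards [hdiff] with s hs
    rw [hw]
    exact hs.hasFDerivAt.comp_hasDerivAt s (hline s)
  refine ⟨hd.mono fun _ h => h.differentiableAt, ?_⟩
  have hD : DifferentiableAt ℝ (fun η => fderiv ℝ u η (F η)) p :=
    ((hu.fderiv_right (m := 1) (by norm_num)).differentiableAt (by norm_num)).clm_apply (hF p)
  have hFp : F p = w := by simpa using hw 0
  have h0 : HasDerivAt (fun s : ℝ => fderiv ℝ u (p + s • w) (F (p + s • w)))
      (fderiv ℝ (fun η => fderiv ℝ u η (F η)) p (F p)) 0 := by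
    rw [hFp]
    have hD' : HasFDerivAt (fun η => fderiv ℝ u η (F η))
        (fderiv ℝ (fun η => fderiv ℝ u η (F η)) p) (p + (0 : ℝ) • w) := by
      simpa using hD.hasFDerivAt
    exact hD'.comp_hasDerivAt 0 (hline 0)
  exact h0.congr_of_eventuallyEq (hd.mono fun _ h => h.deriv)

lemma fderiv_fderiv_add_le {u : H1 → ℝ} {p w : H1} {F : H1 → H1} {ε : ℝ}
    (hu : ContDiffAt ℝ 2 u p) (hF : Differentiable ℝ F) (hw : ∀ s : ℝ, F (p + s • w) = w)
    (hmax : IsLocalMax (fun η : H1 => u η + ε * η.1 ^ 2) p) :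
    fderiv ℝ (fun η => fderiv ℝ u η (F η)) p (F p) + 2 * ε * w.1 ^ 2 ≤ 0 := by
  obtain ⟨hd, hdd⟩ := hasDerivAt_deriv_comp_line hu hF hw
  set g : ℝ → ℝ := fun s => u (p + s • w)
  have hq (s : ℝ) : HasDerivAt (fun s : ℝ => ε * (p.1 + s * w.1) ^ 2)
      (ε * (2 * (p.1 + s * w.1) * w.1)) s := by
    have := ((((hasDerivAt_id s).mul_const w.1).const_add p.1).pow 2).const_mul ε
    simpa using this
  have hq' : HasDerivAt (fun s : ℝ => ε * (2 * (p.1 + s * w.1) * w.1)) (2 * ε * w.1 ^ 2) 0 := by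
    have := ((((hasDerivAt_id (0 : ℝ)).mul_const w.1).const_add p.1).const_mul 2).mul_const w.1
      |>.const_mul ε
    refine this.congr_deriv ?_
    ring
  have hcont : ContinuousAt (fun s : ℝ => p + s • w) 0 := by fun_prop
  have hmax' : IsLocalMax (fun s : ℝ => g s + ε * (p.1 + s * w.1) ^ 2) 0 := by
    have h : Tendsto (fun s : ℝ => p + s • w) (𝓝 0) (𝓝 p) := by
      simpa using hcont.tendsto
    filter_upwards [h.eventually hmax] with s hs
    simpa [g] using hs
  have hderiv : (deriv fun s : ℝ => g s + ε * (p.1 + s * w.1) ^ 2) =ᶠ[𝓝 0]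
      fun s => deriv g s + ε * (2 * (p.1 + s * w.1) * w.1) := by
    filter_upwards [hd] with s hs using (hs.hasDerivAt.add (hq s)).deriv
  rw [← ((hdd.add hq').congr_of_eventuallyEq hderiv).deriv]
  exact hmax'.deriv_deriv_nonpos
    (hd.self_of_nhds.continuousAt.add (hq 0).continuousAt)

/-- Weak maximum principle for functions with vanishing Kohn-Laplacian. -/
lemma le_of_kohn_eq_zero {Ω : Set H1} (hΩo : IsOpen Ω) (hΩb : Bornology.IsBounded Ω) {u : H1 → ℝ}
    (huc : ContinuousOn u (closure Ω)) (hud : ContDiffOn ℝ 2 u Ω) (huh : ∀ η ∈ Ω, kohn u η = 0)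
    {c : ℝ} (hc : ∀ η ∈ frontier Ω, u η ≤ c) {η : H1} (hη : η ∈ Ω) : u η ≤ c := by
  by_contra! hlt
  have hK : IsCompact (closure Ω) := hΩb.isCompact_closure
  obtain ⟨K, hKb⟩ := (hK.image (f := fun η : H1 => η.1 ^ 2) (by fun_prop)).bddAbove
  have hKb' : ∀ ζ ∈ closure Ω, ζ.1 ^ 2 ≤ K := fun ζ hζ => hKb ⟨ζ, hζ, rfl⟩
  have hK0 : 0 ≤ K := (sq_nonneg _).trans (hKb' η (subset_closure hη))
  obtain ⟨ε, hε, hεK⟩ : ∃ ε > 0, c + ε * K < u η := by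
    refine ⟨(u η - c) / (K + 1), div_pos (by linarith) (by linarith), ?_⟩
    have : (u η - c) / (K + 1) * (K + 1) = u η - c := div_mul_cancel₀ _ (by linarith)
    have : 0 < (u η - c) / (K + 1) := div_pos (by linarith) (by linarith)
    linarith
  obtain ⟨p, hp, hpmax⟩ := hK.exists_isMaxOn ⟨η, subset_closure hη⟩
    (f := fun η : H1 => u η + ε * η.1 ^ 2) (huc.add (by fun_prop))
  have hηp : u η + ε * η.1 ^ 2 ≤ u p + ε * p.1 ^ 2 := hpmax (subset_closure hη)
  have hpΩ : p ∈ Ω := by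
    by_contra hpn
    have h1 := hc p ⟨hp, by rwa [hΩo.interior_eq]⟩
    nlinarith [hKb' p hp, sq_nonneg η.1]
  have hnhds := hΩo.mem_nhds hpΩ
  have hmax : IsLocalMax (fun η : H1 => u η + ε * η.1 ^ 2) p :=
    hpmax.isLocalMax (mem_of_superset hnhds subset_closure)
  have hup := hud.contDiffAt hnhds
  have hX := fderiv_fderiv_add_le (w := (1, 0, 2 * p.2.1)) (F := fun η : H1 => (1, 0, 2 * η.2.1))
    hup (by fun_prop) (by simp) hmax
  have hY := fderiv_fderiv_add_le (w := (0, 1, -2 * p.1)) (F := fun η : H1 => (0, 1, -2 * η.1))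
    hup (by fun_prop) (by simp) hmax
  have hk := huh p hpΩ
  change fderiv ℝ (fun η => fderiv ℝ u η (1, 0, 2 * η.2.1)) p (1, 0, 2 * p.2.1) +
    fderiv ℝ (fun η => fderiv ℝ u η (0, 1, -2 * η.1)) p (0, 1, -2 * p.1) = 0 at hk
  norm_num at hX hY hk
  linarith

lemma kohn_neg (u : H1 → ℝ) (η : H1) : kohn (-u) η = -kohn u η := by
  have hX (v : H1 → ℝ) : Xd (-v) = -Xd v := by ext; simp [Xd, fderiv_neg]
  have hY (v : H1 → ℝ) : Yd (-v) = -Yd v := by ext; simp [Yd, fderiv_neg]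
  simp only [kohn, hX, hY, Pi.neg_apply]
  ring

lemma kd_segment_le (ξ η : H1) {s : ℝ} (hs0 : 0 ≤ s) (hs1 : s ≤ 1) :
    kd ξ (ξ + s • (η - ξ)) ≤ kd ξ η := by
  refine le_of_pow_le_pow_left₀ (n := 4) (by norm_num) (kd_nonneg _ _) ?_
  unfold kd
  rw [ρH_pow_four, ρH_pow_four]
  obtain ⟨a, b, c⟩ := ξ
  obtain ⟨x, y, t⟩ := η
  simp only [hmul, hinv, Prod.smul_mk, Prod.mk_add_mk, Prod.mk_sub_mk, smul_eq_mul]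
  have hs2 : s ^ 2 ≤ 1 := pow_le_one₀ hs0 hs1
  have hs4 : s ^ 4 ≤ 1 := pow_le_one₀ hs0 hs1
  have h1 := mul_le_mul_of_nonneg_right hs4 (sq_nonneg ((-a + x) ^ 2 + (-b + y) ^ 2))
  have h2 := mul_le_mul_of_nonneg_right hs2 (sq_nonneg (-c + t + 2 * (x * -b - -a * y)))
  linear_combination h1 + h2

lemma kball_subset_of_le_frontier {Ω : Set H1} (hΩo : IsOpen Ω) {ξ : H1} (hξ : ξ ∈ Ω) {m : ℝ}
    (hm : ∀ η ∈ frontier Ω, m ≤ kd ξ η) : kball ξ m ⊆ Ω := by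
  intro η hη
  have hpre : IsPreconnected ((fun s : ℝ => ξ + s • (η - ξ)) '' Icc 0 1) :=
    isPreconnected_Icc.image _ (by fun_prop)
  have hstart : ξ ∈ (fun s : ℝ => ξ + s • (η - ξ)) '' Icc 0 1 := ⟨0, by simp⟩
  have hend : η ∈ (fun s : ℝ => ξ + s • (η - ξ)) '' Icc 0 1 := ⟨1, by simp⟩
  refine hpre.subset_left_of_subset_union hΩo isClosed_closure.isOpen_compl
    (disjoint_compl_right.mono_left subset_closure) ?_ ⟨ξ, hstart, hξ⟩ hend
  rintro _ ⟨s, hs, rfl⟩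
  by_contra hn
  simp only [mem_union, mem_compl_iff, not_or, not_not] at hn
  have := hm _ ⟨hn.2, by rw [hΩo.interior_eq]; exact hn.1⟩
  exact absurd (this.trans (kd_segment_le ξ η hs.1 hs.2)) (not_le.2 hη)

end

/-- |B(0, r_{Ω(τ)}(ξ))| ≤ α_Ω(ξ)⁴·|Ω(τ)|, where
r_{Ω(τ)}(ξ) = r_Ω(ξ)/√(8πτ r_Ω(ξ)² + 1) and
Ω(τ) = {ξ} ∪ {η ∈ Ω ∖ {ξ} : G_ξ(η) > τ}. -/
theorem level_set_ball_volume_bound (Ω : Set H1) (hΩo : IsOpen Ω)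
    (hΩb : Bornology.IsBounded Ω)
    (ξ : H1) (hξ : ξ ∈ Ω) (H : H1 → ℝ)
    (hHc : ContinuousOn H (closure Ω)) (hHd : ContDiffOn ℝ 2 H Ω)
    (hHh : ∀ η ∈ Ω, kohn H η = 0)
    (hHb : ∀ η ∈ frontier Ω, H η = Γξ ξ η)
    (hHξ : 0 < H ξ) (τ : ℝ) (hτ : 0 < τ) :
    let r : ℝ := 1 / Real.sqrt (8 * π * H ξ)
    let rτ : ℝ := r / Real.sqrt (8 * π * τ * r ^ 2 + 1)
    let G : H1 → ℝ := fun η => Γξ ξ η - H η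
    let Ωτ : Set H1 := {ξ} ∪ {η ∈ Ω \ {ξ} | G η > τ}
    volume (kball 0 rτ) ≤
      ENNReal.ofReal ((sSup (kd ξ '' frontier Ω) / sInf (kd ξ '' frontier Ω)) ^ 4) *
        volume Ωτ := by
  intro r rτ G Ωτ
  have hcomp : IsCompact (kd ξ '' frontier Ω) :=
    (hΩb.isCompact_closure.of_isClosed_subset isClosed_frontier frontier_subset_closure).image
      (continuous_kd ξ)
  have hne : (kd ξ '' frontier Ω).Nonempty := by
    refine (nonempty_frontier_iff.2 ⟨⟨ξ, hξ⟩, fun h => ?_⟩).image _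
    exact NormedSpace.unbounded_univ ℝ H1 (h ▸ hΩb)
  set m := sInf (kd ξ '' frontier Ω) with hmdef
  set M := sSup (kd ξ '' frontier Ω) with hMdef
  have hm : ∀ η ∈ frontier Ω, m ≤ kd ξ η := fun η hη => csInf_le hcomp.bddBelow ⟨η, hη, rfl⟩
  have hM : ∀ η ∈ frontier Ω, kd ξ η ≤ M := fun η hη => le_csSup hcomp.bddAbove ⟨η, hη, rfl⟩
  have hm0 : 0 < m := by
    obtain ⟨η, hη, h⟩ := hcomp.sInf_mem hne
    rw [hmdef, ← h]
    refine kd_pos fun h => hη.2 ?_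
    rwa [hΩo.interior_eq, h]
  have hmM : m ≤ M := by
    obtain ⟨_, η, hη, rfl⟩ := hne
    exact (hm η hη).trans (hM η hη)
  have hM0 : 0 < M := hm0.trans_le hmM
  have hHle : ∀ η ∈ Ω, H η ≤ 1 / (8 * π * m ^ 2) := fun η hη =>
    le_of_kohn_eq_zero hΩo hΩb hHc hHd hHh (fun ζ hζ => by
      rw [hHb ζ hζ, Γξ]
      have := hm ζ hζ
      gcongr) hη
  have hHge : 1 / (8 * π * M ^ 2) ≤ H ξ := by
    have := le_of_kohn_eq_zero (u := -H) (c := -(1 / (8 * π * M ^ 2))) hΩo hΩb hHc.neg hHd.neg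
      (fun η hη => by rw [kohn_neg, hHh η hη, neg_zero]) (fun ζ hζ => by
        rw [Pi.neg_apply, hHb ζ hζ, Γξ]
        have h1 := hM ζ hζ
        have h2 := hm0.trans_le (hm ζ hζ)
        gcongr) hξ
    exact neg_le_neg_iff.1 this
  set s := m / √(8 * π * τ * m ^ 2 + 1) with hs
  have hs0 : 0 < s := by positivity
  have hrM : r ≤ M := by
    have h : 1 / M ≤ √(8 * π * H ξ) := by
      refine Real.le_sqrt_of_sq_le ?_
      rw [div_le_iff₀ (by positivity)] at hHge
      rw [div_pow, one_pow, div_le_iff₀ (by positivity)]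
      linarith
    exact (one_div_le hM0 (by positivity)).1 h
  have hr0 : 0 < r := by positivity
  have hrs : rτ ≤ M / m * s := by
    have hMs : M / m * s = M / √(8 * π * τ * m ^ 2 + 1) := by rw [hs]; field_simp
    rw [hMs]
    have key : r / √(8 * π * τ * r ^ 2 + 1) ≤ M / √(8 * π * τ * M ^ 2 + 1) := by
      rw [div_le_div_iff₀ (by positivity) (by positivity)]
      refine (sq_le_sq₀ (by positivity) (by positivity)).1 ?_
      rw [mul_pow, mul_pow, Real.sq_sqrt (by positivity), Real.sq_sqrt (by positivity)]
      nlinarith [pow_le_pow_left₀ hr0.le hrM 2]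
    refine key.trans ?_
    gcongr
  have hsm : s ≤ m := div_le_self hm0.le (Real.one_le_sqrt.2 (by
    have : 0 < 8 * π * τ * m ^ 2 := by positivity
    linarith))
  have hsub : kball ξ s ⊆ Ωτ := by
    intro η hη
    by_cases h : η = ξ
    · exact Or.inl h
    have hηs : kd ξ η < s := hη
    have hηΩ : η ∈ Ω := kball_subset_of_le_frontier hΩo hξ hm (hηs.trans_le hsm)
    refine Or.inr ⟨⟨hηΩ, h⟩, ?_⟩
    have hd := kd_pos h
    have hΓ : 1 / (8 * π * s ^ 2) < Γξ ξ η := by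
      rw [Γξ]
      gcongr
    have hval : 1 / (8 * π * s ^ 2) = τ + 1 / (8 * π * m ^ 2) := by
      rw [hs, div_pow, Real.sq_sqrt (by positivity)]
      field_simp
    have := hHle η hηΩ
    change τ < Γξ ξ η - H η
    linarith
  calc volume (kball 0 rτ) ≤ ENNReal.ofReal ((M / m) ^ 4) * volume (kball ξ s) :=
        volume_kball_zero_le (div_pos hM0 hm0) hrs ξ
    _ ≤ _ := by gcongr
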